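/- (Independent multi-agent stochastic policy gradient, finite version.) Suppose the joint policy factorizes fully independently, π_θ(a|s) = ∏_{i=1}^n π_{θ_i}(a^i|s), where for each agent i and each (s, a^i) the map θ_i ↦ π_{θ_i}(a^i|s) is continuously differentiable and π_{θ_i}(·|s) is a probability mass function on A_i. Then for each agent i the objective J is differentiable in θ_i and ∇_{θ_i} J(θ) = ∑_{s∈S} ρ^{π_θ}(s) ∑_{a^i∈A_i} ∇_{θ_i} π_{θ_i}(a^i|s) ∑_{a^{-i}} ∏_{j≠i} π_{θ_j}(a^j|s) Q_{π_θ}(s,a), where a^{-i} ranges over ∏_{j≠i} A_j and a denotes the joint action assembled from a^i and a^{-i}. -/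

import Mathlib

open scoped BigOperators Matrix

/-- The discounted visitation matrix `∑ₜ γᵗ Mᵗ` of the transition matrix `M`. -/
noncomputable def discountedVisitation {S : Type*} [Fintype S] [DecidableEq S] (γ : ℝ)
    (M : Matrix S S ℝ) : Matrix S S ℝ :=
  Matrix.of fun s s' => ∑' t : ℕ, γ ^ t * (M ^ t) s s'

section DiscountedVisitation

variable {S : Type*} [Fintype S] [DecidableEq S] {γ : ℝ}

theorem norm_discounted_pow_le (hγ0 : 0 ≤ γ) {M : Matrix S S ℝ}
    (hM : M ∈ Matrix.rowStochastic ℝ S) (s s' : S) (t : ℕ) :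
    ‖γ ^ t * (M ^ t) s s'‖ ≤ γ ^ t := by
  have hMt := pow_mem hM t
  rw [norm_mul, Real.norm_of_nonneg (pow_nonneg hγ0 t),
    Real.norm_of_nonneg (Matrix.nonneg_of_mem_rowStochastic hMt)]
  exact mul_le_of_le_one_right (pow_nonneg hγ0 t) (Matrix.le_one_of_mem_rowStochastic hMt)

theorem summable_discounted_pow (hγ0 : 0 ≤ γ) (hγ1 : γ < 1) {M : Matrix S S ℝ}
    (hM : M ∈ Matrix.rowStochastic ℝ S) (s s' : S) :
    Summable fun t : ℕ => γ ^ t * (M ^ t) s s' :=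
  Summable.of_norm_bounded (summable_geometric_of_lt_one hγ0 hγ1)
    (norm_discounted_pow_le hγ0 hM s s')

theorem hasSum_discountedVisitation (hγ0 : 0 ≤ γ) (hγ1 : γ < 1) {M : Matrix S S ℝ}
    (hM : M ∈ Matrix.rowStochastic ℝ S) :
    HasSum (fun t : ℕ => (γ • M) ^ t) (discountedVisitation γ M) := by
  refine Pi.hasSum.2 fun s => Pi.hasSum.2 fun s' => ?_
  simpa [smul_pow, discountedVisitation] using (summable_discounted_pow hγ0 hγ1 hM s s').hasSum

theorem discountedVisitation_mul_one_sub (hγ0 : 0 ≤ γ) (hγ1 : γ < 1) {M : Matrix S S ℝ}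
    (hM : M ∈ Matrix.rowStochastic ℝ S) :
    discountedVisitation γ M * (1 - γ • M) = 1 := by
  have h := hasSum_discountedVisitation hγ0 hγ1 hM
  rw [← h.tsum_eq]
  exact h.summable.tsum_pow_mul_one_sub

theorem one_sub_mul_discountedVisitation (hγ0 : 0 ≤ γ) (hγ1 : γ < 1) {M : Matrix S S ℝ}
    (hM : M ∈ Matrix.rowStochastic ℝ S) :
    (1 - γ • M) * discountedVisitation γ M = 1 :=
  mul_eq_one_comm.1 (discountedVisitation_mul_one_sub hγ0 hγ1 hM)

theorem continuous_discountedVisitation (hγ0 : 0 ≤ γ) (hγ1 : γ < 1) {E : Type*}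
    [TopologicalSpace E] {M : E → Matrix S S ℝ} (hM : ∀ x, M x ∈ Matrix.rowStochastic ℝ S)
    (hMc : Continuous M) : Continuous fun x => discountedVisitation γ (M x) := by
  refine continuous_matrix fun s s' => continuous_tsum (fun t => ?_)
    (summable_geometric_of_lt_one hγ0 hγ1) fun t x => norm_discounted_pow_le hγ0 (hM x) s s' t
  exact continuous_const.mul ((hMc.pow t).matrix_elem s s')

theorem tsum_discounted_pow_mulVec (hγ0 : 0 ≤ γ) (hγ1 : γ < 1) {M : Matrix S S ℝ}
    (hM : M ∈ Matrix.rowStochastic ℝ S) (R : S → ℝ) (s : S) :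
    ∑' t : ℕ, γ ^ t * ((M ^ t) *ᵥ R) s = (discountedVisitation γ M *ᵥ R) s := by
  simp only [Matrix.mulVec, dotProduct, discountedVisitation, Matrix.of_apply, Finset.mul_sum,
    ← mul_assoc, ← tsum_mul_right]
  exact Summable.tsum_finsetSum fun s' _ => (summable_discounted_pow hγ0 hγ1 hM s s').mul_right _

/-- The performance difference identity for two Markov reward processes. -/
theorem discounted_value_sub (hγ0 : 0 ≤ γ) (hγ1 : γ < 1) {M M₀ : Matrix S S ℝ}
    (hM : M ∈ Matrix.rowStochastic ℝ S) (hM₀ : M₀ ∈ Matrix.rowStochastic ℝ S) (R R₀ : S → ℝ) :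
    discountedVisitation γ M *ᵥ R - discountedVisitation γ M₀ *ᵥ R₀ =
      discountedVisitation γ M *ᵥ
        ((R + γ • M *ᵥ (discountedVisitation γ M₀ *ᵥ R₀)) -
          (R₀ + γ • M₀ *ᵥ (discountedVisitation γ M₀ *ᵥ R₀))) := by
  set V₀ := discountedVisitation γ M₀ *ᵥ R₀ with hV₀
  have h₀ : R₀ + γ • M₀ *ᵥ V₀ = V₀ := by
    have h : (1 - γ • M₀) *ᵥ V₀ = R₀ := by
      rw [hV₀, Matrix.mulVec_mulVec, one_sub_mul_discountedVisitation hγ0 hγ1 hM₀,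
        Matrix.one_mulVec]
    rw [Matrix.sub_mulVec, Matrix.one_mulVec, Matrix.smul_mulVec] at h
    rw [← h, sub_add_cancel]
  have h₁ : discountedVisitation γ M *ᵥ (V₀ - γ • M *ᵥ V₀) = V₀ := by
    have h : V₀ - γ • M *ᵥ V₀ = (1 - γ • M) *ᵥ V₀ := by
      rw [Matrix.sub_mulVec, Matrix.one_mulVec, Matrix.smul_mulVec]
    rw [h, Matrix.mulVec_mulVec, discountedVisitation_mul_one_sub hγ0 hγ1 hM, Matrix.one_mulVec]
  rw [h₀, show R + γ • M *ᵥ V₀ - V₀ = R - (V₀ - γ • M *ᵥ V₀) by abel, Matrix.mulVec_sub, h₁]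

end DiscountedVisitation

/-- A product of a continuous function with a function vanishing at `x₀` and differentiable there
is differentiable at `x₀`. -/
theorem HasFDerivAt.continuousAt_mul_of_eq_zero {E : Type*} [NormedAddCommGroup E]
    [NormedSpace ℝ E] {c g : E → ℝ} {g' : E →L[ℝ] ℝ} {x₀ : E} (hg : HasFDerivAt g g' x₀)
    (hc : ContinuousAt c x₀) (h0 : g x₀ = 0) :
    HasFDerivAt (fun x => c x * g x) (c x₀ • g') x₀ := by
  have hsub : (fun x => (c x - c x₀) * g x) =o[nhds x₀] fun x => x - x₀ := by
    have h1 : (fun x => c x - c x₀) =o[nhds x₀] fun _ => (1 : ℝ) := by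
      rw [Asymptotics.isLittleO_one_iff]
      exact tendsto_sub_nhds_zero_iff.2 hc
    have h2 : g =O[nhds x₀] fun x => x - x₀ := by simpa [h0] using hg.isBigO_sub
    simpa using (h1.mul_isBigO h2.norm_right).norm_right
  have h3 : HasFDerivAt (fun x => (c x - c x₀) * g x) (0 : E →L[ℝ] ℝ) x₀ := by
    rw [hasFDerivAt_iff_isLittleO]
    simpa [h0] using hsub
  convert! h3.add (hg.const_mul (c x₀)) using 1
  · ext x
    simp only [Pi.add_apply]
    ring
  · rw [zero_add]

section PolicyGradient

variable {S A : Type*} [Fintype S] [Fintype A]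

/-- The state transition matrix induced by the policy `p`. -/
def policyTransition (P : S → A → S → ℝ) (p : S → A → ℝ) : Matrix S S ℝ :=
  Matrix.of fun s s' => ∑ a, p s a * P s a s'

/-- The expected one-step reward under the policy `p`. -/
def policyReward (r : S → A → ℝ) (p : S → A → ℝ) (s : S) : ℝ :=
  ∑ a, p s a * r s a

theorem policyTransition_mem_rowStochastic [DecidableEq S] {P : S → A → S → ℝ}
    (hP0 : ∀ s a s', 0 ≤ P s a s') (hP1 : ∀ s a, ∑ s', P s a s' = 1) {p : S → A → ℝ}
    (hp0 : ∀ s a, 0 ≤ p s a) (hp1 : ∀ s, ∑ a, p s a = 1) :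
    policyTransition P p ∈ Matrix.rowStochastic ℝ S := by
  rw [Matrix.mem_rowStochastic_iff_sum]
  refine ⟨fun s s' => Finset.sum_nonneg fun a _ => mul_nonneg (hp0 s a) (hP0 s a s'), fun s => ?_⟩
  simp only [policyTransition, Matrix.of_apply]
  rw [Finset.sum_comm]
  simp [← Finset.mul_sum, hP1, hp1]

theorem policyReward_add_smul_policyTransition_mulVec (P : S → A → S → ℝ) (r : S → A → ℝ)
    (p : S → A → ℝ) (γ : ℝ) (W : S → ℝ) (s : S) :
    (policyReward r p + γ • policyTransition P p *ᵥ W) s =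
      ∑ a, p s a * (r s a + γ * ∑ s', P s a s' * W s') := by
  have h : ∑ s', (∑ a, p s a * P s a s') * W s' = ∑ a, p s a * ∑ s', P s a s' * W s' := by
    simp only [Finset.sum_mul, Finset.mul_sum, mul_assoc]
    exact Finset.sum_comm
  simp only [Pi.add_apply, Pi.smul_apply, smul_eq_mul, Matrix.mulVec, dotProduct, policyReward,
    policyTransition, Matrix.of_apply, h, mul_add, Finset.sum_add_distrib, add_right_inj]
  rw [Finset.mul_sum]
  exact Finset.sum_congr rfl fun a _ => by ring

/-- The policy gradient theorem for a finite discounted Markov decision process. -/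
theorem hasFDerivAt_discounted_value [DecidableEq S] {E : Type*} [NormedAddCommGroup E]
    [NormedSpace ℝ E] {P : S → A → S → ℝ}
    (hP0 : ∀ s a s', 0 ≤ P s a s') (hP1 : ∀ s a, ∑ s', P s a s' = 1) (r : S → A → ℝ)
    {γ : ℝ} (hγ0 : 0 ≤ γ) (hγ1 : γ < 1) {p : E → S → A → ℝ}
    (hp0 : ∀ x s a, 0 ≤ p x s a) (hp1 : ∀ x s, ∑ a, p x s a = 1)
    (hpc : ∀ s a, Continuous fun x => p x s a) {p' : S → A → E →L[ℝ] ℝ} {x₀ : E}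
    (hp' : ∀ s a, HasFDerivAt (fun x => p x s a) (p' s a) x₀) (s₀ : S) :
    HasFDerivAt
      (fun x => (discountedVisitation γ (policyTransition P (p x)) *ᵥ policyReward r (p x)) s₀)
      (∑ s, discountedVisitation γ (policyTransition P (p x₀)) s₀ s • ∑ a,
        (r s a + γ * ∑ s', P s a s' *
          (discountedVisitation γ (policyTransition P (p x₀)) *ᵥ policyReward r (p x₀)) s') •
          p' s a) x₀ := by
  set V₀ := discountedVisitation γ (policyTransition P (p x₀)) *ᵥ policyReward r (p x₀) with hV₀
  set Q : S → A → ℝ := fun s a => r s a + γ * ∑ s', P s a s' * V₀ s' with hQ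
  have hM : ∀ x, policyTransition P (p x) ∈ Matrix.rowStochastic ℝ S := fun x =>
    policyTransition_mem_rowStochastic hP0 hP1 (hp0 x) (hp1 x)
  have hMc : Continuous fun x => policyTransition P (p x) :=
    continuous_matrix fun s s' =>
      continuous_finsetSum _ fun a _ => (hpc s a).mul continuous_const
  have hdiff : ∀ x,
      (discountedVisitation γ (policyTransition P (p x)) *ᵥ policyReward r (p x)) s₀ =
        V₀ s₀ + ∑ s, discountedVisitation γ (policyTransition P (p x)) s₀ s *
          (∑ a, p x s a * Q s a - ∑ a, p x₀ s a * Q s a) := fun x => by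
    have h := congrFun (discounted_value_sub hγ0 hγ1 (hM x) (hM x₀)
      (policyReward r (p x)) (policyReward r (p x₀))) s₀
    rw [Pi.sub_apply, sub_eq_iff_eq_add', ← hV₀] at h
    rw [h]
    simp only [Matrix.mulVec, dotProduct, Pi.sub_apply]
    congr 1
    refine Finset.sum_congr rfl fun s _ => ?_
    rw [← policyReward_add_smul_policyTransition_mulVec,
      ← policyReward_add_smul_policyTransition_mulVec]
  rw [funext hdiff]
  refine HasFDerivAt.const_add _ (HasFDerivAt.fun_sum fun s _ => ?_)
  refine HasFDerivAt.continuousAt_mul_of_eq_zero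
    (HasFDerivAt.sub_const _ (HasFDerivAt.fun_sum fun a _ => (hp' s a).mul_const (Q s a)))
    ?_ (sub_self _)
  exact ((continuous_discountedVisitation hγ0 hγ1 hM hMc).matrix_elem s₀ s).continuousAt

end PolicyGradient


open scoped BigOperators

/-- Independent multi-agent stochastic policy gradient (finite version):
with a fully independent factorized joint policy `π θ (a|s) = ∏ i, π_i (θ i) (a^i|s)`,
the objective `J` is differentiable in each `θ i` and
`∇_{θ_i} J(θ) = ∑ s, ρ^{π_θ}(s) • ∑ a, (∏_{j ≠ i} π_j (θ j) (a^j|s)) * Q(s,a) •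
∇_{θ_i} π_i (θ i) (a^i|s)` (summing over joint actions `a` combines the sums over
`a^i ∈ A_i` and `a^{-i} ∈ ∏_{j≠i} A_j`). -/
theorem independent_multiagent_policy_gradient
    {S : Type*} [Fintype S] [Nonempty S] [DecidableEq S]
    {n : ℕ} (Ai : Fin n → Type*) [∀ i, Fintype (Ai i)] [∀ i, Nonempty (Ai i)]
    [∀ i, DecidableEq (Ai i)]
    (d : Fin n → ℕ)
    (P : S → (∀ i, Ai i) → S → ℝ)
    (hP0 : ∀ s a s', 0 ≤ P s a s')
    (hP1 : ∀ s a, ∑ s', P s a s' = 1)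
    (r : S → (∀ i, Ai i) → ℝ)
    (γ : ℝ) (hγ0 : 0 ≤ γ) (hγ1 : γ < 1)
    -- the individual parameterized policies π_{θ_i}
    (πi : ∀ i, (Fin (d i) → ℝ) → S → Ai i → ℝ)
    (hπ0 : ∀ i x s b, 0 ≤ πi i x s b)
    (hπ1 : ∀ i x s, ∑ b, πi i x s b = 1)
    (hπC1 : ∀ i s b, ContDiff ℝ 1 (fun x : Fin (d i) → ℝ => πi i x s b))
    -- the t-step state distribution under the joint policy ∏ i, π_{θ_i}
    (T : (∀ i, Fin (d i) → ℝ) → ℕ → S → S → ℝ)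
    (hT0 : ∀ θ s s', T θ 0 s s' = if s' = s then 1 else 0)
    (hTsucc : ∀ θ t s s'', T θ (t + 1) s s'' =
      ∑ s', T θ t s s' * ∑ a : ∀ i, Ai i, (∏ i, πi i (θ i) s' (a i)) * P s' a s'')
    -- the value function V_{π_θ}
    (V : (∀ i, Fin (d i) → ℝ) → S → ℝ)
    (hV : ∀ θ s, V θ s = ∑' t : ℕ, γ ^ t *
      ∑ s', T θ t s s' * ∑ a : ∀ i, Ai i, (∏ i, πi i (θ i) s' (a i)) * r s' a)
    -- the action-value function Q_{π_θ}
    (Q : (∀ i, Fin (d i) → ℝ) → S → (∀ i, Ai i) → ℝ)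
    (hQ : ∀ θ s a, Q θ s a = r s a + γ * ∑ s', P s a s' * V θ s')
    -- the initial state distribution ρ₀
    (ρ0 : S → ℝ) (hρ00 : ∀ s, 0 ≤ ρ0 s) (hρ01 : ∑ s, ρ0 s = 1)
    -- the discounted state distribution ρ^{π_θ}
    (ρd : (∀ i, Fin (d i) → ℝ) → S → ℝ)
    (hρd : ∀ θ s, ρd θ s = ∑ s0, ρ0 s0 * ∑' t : ℕ, γ ^ t * T θ t s0 s)
    -- the objective J(θ)
    (J : (∀ i, Fin (d i) → ℝ) → ℝ)
    (hJ : ∀ θ, J θ = ∑ s, ρ0 s * V θ s)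
    (θ : ∀ i, Fin (d i) → ℝ) (i : Fin n) :
    HasFDerivAt (fun x : Fin (d i) → ℝ => J (Function.update θ i x))
      (∑ s, ρd θ s • ∑ a : ∀ j, Ai j,
        ((∏ j ∈ Finset.univ.erase i, πi j (θ j) s (a j)) * Q θ s a) •
          fderiv ℝ (fun x : Fin (d i) → ℝ => πi i x s (a i)) (θ i))
      (θ i) := by
  classical
  set p : (∀ i, Fin (d i) → ℝ) → S → (∀ i, Ai i) → ℝ :=
    fun η s a => ∏ i, πi i (η i) s (a i) with hp
  have hp0 : ∀ η s a, 0 ≤ p η s a := fun η s a => Finset.prod_nonneg fun j _ => hπ0 j _ s _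
  have hp1 : ∀ η s, ∑ a, p η s a = 1 := fun η s => by
    simp only [hp, ← Fintype.prod_sum, hπ1, Finset.prod_const_one]
  have hM : ∀ η, policyTransition P (p η) ∈ Matrix.rowStochastic ℝ S := fun η =>
    policyTransition_mem_rowStochastic hP0 hP1 (hp0 η) (hp1 η)
  have hT : ∀ η t s s', T η t s s' = (policyTransition P (p η) ^ t) s s' := by
    intro η t
    induction t with
    | zero => intro s s'; simp [hT0, Matrix.one_apply, eq_comm]
    | succ t ih =>
      intro s s'
      rw [hTsucc, pow_succ, Matrix.mul_apply]
      exact Finset.sum_congr rfl fun u _ => by rw [ih]; rfl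
  have hVN : ∀ η s, V η s =
      (discountedVisitation γ (policyTransition P (p η)) *ᵥ policyReward r (p η)) s := by
    intro η s
    rw [hV, ← tsum_discounted_pow_mulVec hγ0 hγ1 (hM η)]
    simp only [hT]
    rfl
  have hρN : ∀ s, ρd θ s =
      ∑ s0, ρ0 s0 * discountedVisitation γ (policyTransition P (p θ)) s0 s := by
    intro s
    simp only [hρd, hT]
    rfl
  have hpu : ∀ x s a, p (Function.update θ i x) s a =
      (∏ j ∈ Finset.univ.erase i, πi j (θ j) s (a j)) * πi i x s (a i) := by
    intro x s a
    simp only [hp]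
    rw [← Finset.prod_erase_mul _ _ (Finset.mem_univ i), Function.update_self]
    congr 1
    exact Finset.prod_congr rfl fun j hj => by
      rw [Function.update_of_ne (Finset.ne_of_mem_erase hj)]
  have hp' : ∀ s a, HasFDerivAt (fun x => p (Function.update θ i x) s a)
      ((∏ j ∈ Finset.univ.erase i, πi j (θ j) s (a j)) •
        fderiv ℝ (fun x : Fin (d i) → ℝ => πi i x s (a i)) (θ i)) (θ i) := by
    intro s a
    simp only [hpu]
    exact (((hπC1 i s (a i)).differentiable one_ne_zero) (θ i)).hasFDerivAt.const_mul _
  have hpc : ∀ s a, Continuous fun x => p (Function.update θ i x) s a := by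
    intro s a
    simp only [hpu]
    exact continuous_const.mul (hπC1 i s (a i)).continuous
  have key := fun s₀ => hasFDerivAt_discounted_value hP0 hP1 r hγ0 hγ1
    (p := fun x => p (Function.update θ i x)) (fun x => hp0 _) (fun x => hp1 _) hpc hp' s₀
  simp only [Function.update_eq_self, ← hVN, ← hQ] at key
  have hsum := HasFDerivAt.fun_sum (u := Finset.univ) fun s₀ _ => (key s₀).const_mul (ρ0 s₀)
  simp only [hJ]
  convert! hsum using 1
  simp only [hρN, Finset.sum_smul]
  simp only [Finset.smul_sum, smul_smul]
  rw [Finset.sum_comm]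
  refine Finset.sum_congr rfl fun s₀ _ => Finset.sum_congr rfl fun s _ =>
    Finset.sum_congr rfl fun a _ => ?_
  congr 1
  ring
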